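/- Let 2 ≤ k ≤ n−2, with the convention that a (2,n) pseudo-GCO is a single (2,n) color ordering. The dual map assigns to a (k,n) pseudo-GCO Σ the (n−k,n) pre-GCO Σ′ whose component at an (n−k−2)-element subset {i_1,…,i_{n−k−2}} ⊆ [n] is the unique (2,k+2) color ordering whose degree-k descendant equals the iterated k-preserving projection π_{i_1}π_{i_2}⋯π_{i_{n−k−2}}(Σ). This map is well defined (each such iterated projection of a pseudo-GCO is a (k,k+2) pseudo-GCO and hence the descendant of a unique (2,k+2) color ordering), the dual Σ′ is an (n−k,n) pseudo-GCO, and the dual map is a bijection from the set of (k,n) pseudo-GCOs onto the set of (n−k,n) pseudo-GCOs, whose inverse is the dual map from (n−k,n) to (k,n). -/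

import Mathlib

/-- Dihedral equivalence of lists: `l₂` is obtained from `l₁` by a rotation,
possibly composed with a reversal.  Two cyclic words represent the same
(2,m) color ordering iff they are dihedrally equivalent. -/
def DihEquiv {α : Type*} (l₁ l₂ : List α) : Prop :=
  List.IsRotated l₁ l₂ ∨ List.IsRotated l₁.reverse l₂

theorem dihEquiv_refl {α : Type*} (l : List α) : DihEquiv l l :=
  Or.inl (List.IsRotated.refl l)

theorem dihEquiv_symm {α : Type*} {l₁ l₂ : List α} (h : DihEquiv l₁ l₂) : DihEquiv l₂ l₁ := by
  rcases h with h | h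
  · exact Or.inl h.symm
  · have h2 := h.reverse
    rw [List.reverse_reverse] at h2
    exact Or.inr h2.symm

theorem dihEquiv_trans {α : Type*} {l₁ l₂ l₃ : List α} (h : DihEquiv l₁ l₂)
    (h' : DihEquiv l₂ l₃) : DihEquiv l₁ l₃ := by
  rcases h with h | h <;> rcases h' with h' | h'
  · exact Or.inl (h.trans h')
  · exact Or.inr (h.reverse.trans h')
  · exact Or.inr (h.trans h')
  · have h2 := h.reverse
    rw [List.reverse_reverse] at h2
    exact Or.inl (h2.trans h')

/-- A `(k, S.card)` pre-GCO on the label set `S`, given by representatives: to every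
`(k-2)`-element subset `I ⊆ S` it assigns a cyclic word on `S \ I` (a representative of
a `(2, S.card - k + 2)` color ordering).  Values of `σ` on other subsets are irrelevant. -/
def IsPreGCO (k : ℕ) (S : Finset ℕ) (σ : Finset ℕ → List ℕ) : Prop :=
  ∀ I : Finset ℕ, I ⊆ S → I.card = k - 2 →
    (σ I).Nodup ∧ (σ I).toFinset = S \ I

/-- The recursive pseudo-GCO condition on a `(k, S.card)` pre-GCO (given by
representatives).  For `S.card = k + 2` it says that the pre-GCO is the descendant of a
`(2, k+2)` color ordering (represented by `base`); for `S.card > k + 2` it requires all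
`k`-preserving projections (delete the component at subsets containing `i`, and delete
the label `i` from the remaining components) to be pseudo-GCOs. -/
def IsPseudoGCO (k : ℕ) (S : Finset ℕ) (σ : Finset ℕ → List ℕ) : Prop :=
  if S.card ≤ k + 2 then
    ∃ base : List ℕ, base.Nodup ∧ base.toFinset = S ∧
      ∀ I : Finset ℕ, I ⊆ S → I.card = k - 2 →
        DihEquiv (σ I) (base.filter (fun x => x ∉ I))
  else
    ∀ i ∈ S, IsPseudoGCO k (S.erase i) (fun I => (σ I).filter (fun x => x ≠ i))
termination_by S.card
decreasing_by exact Finset.card_erase_lt_of_mem ‹_›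

/-- `τ` (a pre-GCO of type `(S.card - k, S.card)`) is the dual of the `(k, S.card)`
pre-GCO `σ`: for every `(S.card - k - 2)`-element subset `I ⊆ S`, the component of `τ`
at `I` is the `(2, k+2)` color ordering whose degree-`k` descendant equals the iterated
`k`-preserving projection of `σ` deleting the labels in `I`. -/
def IsDualPair (k : ℕ) (S : Finset ℕ) (σ τ : Finset ℕ → List ℕ) : Prop :=
  ∀ I : Finset ℕ, I ⊆ S → I.card = S.card - k - 2 →
    ∀ J : Finset ℕ, J ⊆ S \ I → J.card = k - 2 →
      DihEquiv ((σ J).filter (fun x => x ∉ I)) ((τ I).filter (fun x => x ∉ J))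

theorem List.IsRotated.filter {α : Type*} (p : α → Bool) {l₁ l₂ : List α}
    (h : l₁ ~r l₂) : l₁.filter p ~r l₂.filter p := by
  obtain ⟨n, hn, rfl⟩ := List.isRotated_iff_mod.1 h
  rw [List.rotate_eq_drop_append_take hn, List.filter_append]
  conv_lhs => rw [← List.take_append_drop n l₁, List.filter_append]
  exact List.isRotated_append

/-- Restriction of labels respects dihedral equivalence. -/
theorem DihEquiv.filter {α : Type*} (p : α → Bool) {l₁ l₂ : List α}
    (h : DihEquiv l₁ l₂) : DihEquiv (l₁.filter p) (l₂.filter p) := by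
  rcases h with h | h
  · exact Or.inl (h.filter p)
  · refine Or.inr ?_
    rw [← List.filter_reverse]
    exact h.filter p

theorem List.IsRotated.eq_of_nodup_cons {α : Type*} {a : α} {l₁ l₂ : List α}
    (hd : (a :: l₁).Nodup) (h : (a :: l₁) ~r (a :: l₂)) : l₁ = l₂ := by
  obtain ⟨n, hn, h⟩ := List.isRotated_iff_mod.1 h
  rw [List.rotate_eq_drop_append_take hn] at h
  rcases n with _ | n
  · simpa using h
  · simp only [List.drop_succ_cons, List.take_succ_cons] at h
    have ha : a ∉ l₁.drop n := fun hm => (List.nodup_cons.1 hd).1 (List.mem_of_mem_drop hm)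
    cases hdr : l₁.drop n with
    | nil =>
      rw [hdr, List.nil_append, List.cons.injEq] at h
      rw [← h.2]
      conv_lhs => rw [← List.take_append_drop n l₁, hdr, List.append_nil]
    | cons b r =>
      rw [hdr, List.cons_append, List.cons.injEq] at h
      rw [hdr, h.1] at ha
      simp at ha

/-- Nodup words starting with the same label are dihedrally equivalent only if their tails
agree up to reversal. -/
theorem DihEquiv.eq_or_reverse_eq {α : Type*} {a : α} {l₁ l₂ : List α}
    (hd : (a :: l₁).Nodup) (h : DihEquiv (a :: l₁) (a :: l₂)) : l₁ = l₂ ∨ l₁.reverse = l₂ := by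
  rcases h with h | h
  · exact Or.inl (h.eq_of_nodup_cons hd)
  · refine Or.inr (List.IsRotated.eq_of_nodup_cons (a := a) ?_ ?_)
    · simpa using hd
    · rw [List.reverse_cons] at h
      exact (List.isRotated_append (l := [a]) (l' := l₁.reverse)).trans h

/-- A word is determined by its restrictions to pairs of labels. -/
theorem List.eq_of_filter_pair_eq {α : Type*} [DecidableEq α] (p q : List α)
    (h : ∀ y z : α, p.filter (· ∈ ({y, z} : Finset α)) = q.filter (· ∈ ({y, z} : Finset α))) :
    p = q := by
  induction p generalizing q with
  | nil =>
    cases q with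
    | nil => rfl
    | cons z q => simpa using h z z
  | cons y p ih =>
    cases q with
    | nil => simpa using h y y
    | cons z q =>
      have hyz : y = z := by
        have := h y z
        rw [List.filter_cons_of_pos (by simp), List.filter_cons_of_pos (by simp)] at this
        exact (List.cons.inj this).1
      subst hyz
      rw [ih q]
      intro u v
      have := h u v
      by_cases hy : y ∈ ({u, v} : Finset α)
      · rw [List.filter_cons_of_pos (by simpa using hy),
          List.filter_cons_of_pos (by simpa using hy)] at this
        exact (List.cons.inj this).2
      · rwa [List.filter_cons_of_neg (by simpa using hy),
          List.filter_cons_of_neg (by simpa using hy)] at this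

theorem List.eq_of_filter_triple_of_head_eq {α : Type*} [DecidableEq α] {x : α} {p q : List α}
    (hp : (x :: p).Nodup)
    (h : ∀ y z : α,
      (x :: p).filter (· ∈ ({x, y, z} : Finset α)) = (x :: q).filter (· ∈ ({x, y, z} : Finset α)) ∨
      ((x :: p).filter (· ∈ ({x, y, z} : Finset α))).reverse =
        (x :: q).filter (· ∈ ({x, y, z} : Finset α))) :
    p = q := by
  have key : ∀ (l : List α) (y z : α),
      l.filter (· ∈ ({y, z} : Finset α)) =
        (l.filter (· ∈ ({x, y, z} : Finset α))).filter (· ∈ ({y, z} : Finset α)) := by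
    intro l y z
    rw [List.filter_filter]
    refine List.filter_congr fun w _ => ?_
    simp only [Finset.mem_insert, Finset.mem_singleton]
    grind
  refine List.eq_of_filter_pair_eq p q fun y z => ?_
  rw [key p, key q]
  congr 1
  have h := h y z
  rw [List.filter_cons_of_pos (by simp), List.filter_cons_of_pos (by simp)] at h
  rcases h with h | h
  · exact (List.cons.inj h).2
  · have hx : x ∉ (p.filter (· ∈ ({x, y, z} : Finset α))).reverse := fun hm =>
      (List.nodup_cons.1 hp).1 (List.mem_of_mem_filter (List.mem_reverse.1 hm))
    rw [List.reverse_cons] at h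
    cases hr : (p.filter (· ∈ ({x, y, z} : Finset α))).reverse with
    | nil =>
      rw [hr, List.nil_append] at h
      rw [List.reverse_eq_nil_iff.1 hr]
      exact (List.cons.inj h).2
    | cons b r =>
      rw [hr, List.cons_append] at h
      rw [hr, (List.cons.inj h).1] at hx
      simp at hx

/-- A linear order is determined up to reversal by its betweenness relation, i.e. by its
restrictions to triples up to reversal. -/
theorem List.eq_or_reverse_eq_of_filter_triple {α : Type*} [DecidableEq α] {p q : List α}
    (hp : p.Nodup) (hq : q.Nodup) (hpq : ∀ a, a ∈ p ↔ a ∈ q)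
    (h : ∀ x y z : α,
      p.filter (· ∈ ({x, y, z} : Finset α)) = q.filter (· ∈ ({x, y, z} : Finset α)) ∨
      (p.filter (· ∈ ({x, y, z} : Finset α))).reverse = q.filter (· ∈ ({x, y, z} : Finset α))) :
    p = q ∨ p.reverse = q := by
  cases p with
  | nil =>
    left
    symm
    rw [List.eq_nil_iff_forall_not_mem]
    intro a ha
    simpa using (hpq a).2 ha
  | cons x p =>
    obtain ⟨u, v, rfl⟩ := List.append_of_mem ((hpq x).1 (by simp))
    rcases u with _ | ⟨y, u⟩
    · left
      rw [List.nil_append] at hq h ⊢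
      rw [List.eq_of_filter_triple_of_head_eq hp fun y z => h x y z]
    rcases List.eq_nil_or_concat v with rfl | ⟨v, z, rfl⟩
    · right
      have : p = (y :: u).reverse := by
        refine List.eq_of_filter_triple_of_head_eq hp fun b c => ?_
        have hr : x :: (y :: u).reverse = (y :: u ++ [x]).reverse := by simp
        rw [hr, List.filter_reverse]
        rcases h x b c with h | h
        · exact Or.inr (congrArg List.reverse h)
        · exact Or.inl (by rw [← h, List.reverse_reverse])
      rw [this]
      simp
    · exfalso
      have hxy : x ≠ y := by rintro rfl; simp at hq
      have hxz : x ≠ z := by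
        rintro rfl
        simp [List.nodup_append] at hq
      have h := h x y z
      rw [List.filter_cons_of_pos (by simp)] at h
      rw [List.cons_append, List.filter_cons_of_pos (by simp)] at h
      rcases h with h | h
      · exact hxy (List.cons.inj h).1
      · have h := congrArg List.getLast? h
        have hz : u ++ x :: v.concat z = u ++ x :: v ++ [z] := by simp
        rw [List.reverse_cons, List.getLast?_concat, hz, List.filter_append,
          List.filter_cons_of_pos (by simp), List.filter_nil, ← List.cons_append,
          List.getLast?_concat] at h
        exact hxz (Option.some.inj h)

/-- A cyclic word is determined up to dihedral equivalence by its restrictions to quadruples. -/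
theorem dihEquiv_of_filter_quadruple {α : Type*} [DecidableEq α] {l₁ l₂ : List α}
    (h₁ : l₁.Nodup) (h₂ : l₂.Nodup) (hl : l₁.toFinset = l₂.toFinset)
    (h : ∀ a x y z : α, DihEquiv (l₁.filter (· ∈ ({a, x, y, z} : Finset α)))
      (l₂.filter (· ∈ ({a, x, y, z} : Finset α)))) :
    DihEquiv l₁ l₂ := by
  have hmem : ∀ a, a ∈ l₁ ↔ a ∈ l₂ := fun a => by
    rw [← List.mem_toFinset, hl, List.mem_toFinset]
  cases l₁ with
  | nil =>
    have : l₂ = [] := List.eq_nil_iff_forall_not_mem.2 fun a ha => by simpa using (hmem a).2 ha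
    rw [this]
    exact dihEquiv_refl _
  | cons a p =>
    obtain ⟨u, v, rfl⟩ := List.append_of_mem ((hmem a).1 (by simp))
    have hrot : (u ++ a :: v) ~r (a :: (v ++ u)) := List.isRotated_append
    have hq : (a :: (v ++ u)).Nodup := hrot.nodup_iff.1 h₂
    have hmem' : ∀ b, b ∈ p ↔ b ∈ v ++ u := by
      intro b
      have h3 := (hmem b).trans hrot.mem_iff
      by_cases hb : b = a
      · subst hb
        exact iff_of_false (List.nodup_cons.1 h₁).1 (List.nodup_cons.1 hq).1
      · simpa only [List.mem_cons, hb, false_or] using h3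
    have key : ∀ l : List α, (a :: l).Nodup → ∀ x y z : α,
        (a :: l).filter (· ∈ ({a, x, y, z} : Finset α)) =
          a :: l.filter (· ∈ ({x, y, z} : Finset α)) := by
      intro l hd x y z
      rw [List.filter_cons_of_pos (by simp)]
      congr 1
      refine List.filter_congr fun w hw => ?_
      have : w ≠ a := by rintro rfl; exact (List.nodup_cons.1 hd).1 hw
      simp [this]
    have hlin : p = v ++ u ∨ p.reverse = v ++ u := by
      refine List.eq_or_reverse_eq_of_filter_triple (List.nodup_cons.1 h₁).2
        (List.nodup_cons.1 hq).2 hmem' fun x y z => ?_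
      have h4 := dihEquiv_trans (h a x y z) (Or.inl (hrot.filter _))
      rw [key p h₁, key _ hq] at h4
      refine h4.eq_or_reverse_eq ?_
      rw [← key p h₁]
      exact h₁.filter _
    refine dihEquiv_trans ?_ (Or.inl hrot.symm)
    rcases hlin with h5 | h5
    · rw [h5]
      exact dihEquiv_refl _
    · rw [← h5]
      refine Or.inr ?_
      rw [List.reverse_cons]
      exact List.isRotated_append

/-- A color ordering on at least four labels is determined by its descendant. -/
theorem dihEquiv_of_descendant {T : Finset ℕ} {m : ℕ} (hT : T.card = m + 4)
    {l₁ l₂ : List ℕ} (h₁ : l₁.Nodup) (hl₁ : l₁.toFinset = T)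
    (h₂ : l₂.Nodup) (hl₂ : l₂.toFinset = T)
    (h : ∀ J : Finset ℕ, J ⊆ T → J.card = m →
      DihEquiv (l₁.filter (fun x => x ∉ J)) (l₂.filter (fun x => x ∉ J))) :
    DihEquiv l₁ l₂ := by
  refine dihEquiv_of_filter_quadruple h₁ h₂ (hl₁.trans hl₂.symm) fun a x y z => ?_
  obtain ⟨Q, hQ, hQT, hcard⟩ := Finset.exists_subsuperset_card_eq
    (s := ({a, x, y, z} : Finset ℕ) ∩ T) (t := T) (n := 4) Finset.inter_subset_right
    ((Finset.card_le_card Finset.inter_subset_left).trans Finset.card_le_four) (by omega)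
  have hf : ∀ l : List ℕ, l.toFinset = T →
      (l.filter (fun x => x ∉ T \ Q)).filter (· ∈ ({a, x, y, z} : Finset ℕ)) =
        l.filter (· ∈ ({a, x, y, z} : Finset ℕ)) := by
    intro l hl
    rw [List.filter_filter]
    refine List.filter_congr fun w hw => ?_
    have hwT : w ∈ T := by rw [← hl]; exact List.mem_toFinset.2 hw
    by_cases hw' : w ∈ ({a, x, y, z} : Finset ℕ)
    · have := hQ (Finset.mem_inter.2 ⟨hw', hwT⟩)
      simp only [Finset.mem_sdiff, this, hw']
      simp
    · simp only [hw']
      simp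
  have h3 := (h (T \ Q) Finset.sdiff_subset
    (by rw [Finset.card_sdiff_of_subset hQT]; omega)).filter (· ∈ ({a, x, y, z} : Finset ℕ))
  rwa [hf l₁ hl₁, hf l₂ hl₂] at h3

/-- The pseudo-GCO recursion unfolded: every iterated projection to `k + 2` labels is the
descendant of a color ordering. -/
theorem isPseudoGCO_iff {k : ℕ} {S : Finset ℕ} (hS : k + 2 ≤ S.card)
    (σ : Finset ℕ → List ℕ) :
    IsPseudoGCO k S σ ↔ ∀ I : Finset ℕ, I ⊆ S → I.card = S.card - k - 2 →
      ∃ base : List ℕ, base.Nodup ∧ base.toFinset = S \ I ∧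
        ∀ J : Finset ℕ, J ⊆ S \ I → J.card = k - 2 →
          DihEquiv ((σ J).filter (fun x => x ∉ I)) (base.filter (fun x => x ∉ J)) := by
  induction hm : S.card generalizing S σ with
  | zero => omega
  | succ m ih =>
    rw [IsPseudoGCO]
    split_ifs with hle
    · have h0 : m + 1 - k - 2 = 0 := by omega
      simp only [h0, Finset.card_eq_zero]
      constructor
      · rintro h I - rfl
        simpa using h
      · intro h
        simpa using h ∅ (Finset.empty_subset S) rfl
    · have hff : ∀ (i : ℕ) (I' J : Finset ℕ),
          ((σ J).filter (fun x => x ≠ i)).filter (fun x => x ∉ I') =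
            (σ J).filter (fun x => x ∉ insert i I') := by
        intro i I' J
        rw [List.filter_filter]
        refine List.filter_congr fun w _ => ?_
        simp [Bool.and_comm]
      have hSi : ∀ i I', S.erase i \ I' = S \ insert i I' := by
        intro i I'
        ext w
        simp only [Finset.mem_sdiff, Finset.mem_erase, Finset.mem_insert]
        tauto
      have hcard : ∀ i ∈ S, (S.erase i).card = m := fun i hi => by
        rw [Finset.card_erase_of_mem hi]; omega
      constructor
      · intro h I hI hIc
        obtain ⟨i, hi⟩ : I.Nonempty := by
          rw [← Finset.card_pos]; omega
        have h1 := (ih (S := S.erase i) (by rw [hcard i (hI hi)]; omega) _ (hcard i (hI hi))).1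
          (h i (hI hi)) (I.erase i) (Finset.erase_subset_erase i hI)
          (by rw [Finset.card_erase_of_mem hi]; omega)
        simpa only [hff, hSi, Finset.insert_erase hi] using h1
      · intro h i hi
        refine (ih (S := S.erase i) (by rw [hcard i hi]; omega) _ (hcard i hi)).2 ?_
        intro I' hI' hc
        have hni : i ∉ I' := fun hm => by simpa using hI' hm
        simp only [hff, hSi]
        exact h (insert i I')
          (Finset.insert_subset hi (hI'.trans (Finset.erase_subset i S)))
          (by rw [Finset.card_insert_of_notMem hni]; omega)

theorem IsDualPair.symm {k : ℕ} {S : Finset ℕ} (hS : k + 2 ≤ S.card)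
    {σ τ : Finset ℕ → List ℕ} (h : IsDualPair k S σ τ) : IsDualPair (S.card - k) S τ σ := by
  intro J hJ hJc I hI hIc
  rw [Finset.subset_sdiff] at hI
  refine dihEquiv_symm (h I hI.1 hIc J ?_ (by omega))
  exact Finset.subset_sdiff.2 ⟨hJ, hI.2.symm⟩

/-- A tuple with a dual pre-GCO is a pseudo-GCO. -/
theorem IsDualPair.isPseudoGCO {k : ℕ} {S : Finset ℕ} (hS : k + 2 ≤ S.card)
    {σ τ : Finset ℕ → List ℕ} (hτ : IsPreGCO (S.card - k) S τ) (h : IsDualPair k S σ τ) :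
    IsPseudoGCO k S σ :=
  (isPseudoGCO_iff hS σ).2 fun I hI hIc =>
    ⟨τ I, (hτ I hI hIc).1, (hτ I hI hIc).2, h I hI hIc⟩

/-- Every pseudo-GCO which is a pre-GCO has a dual, and the dual is a pseudo-GCO. -/
theorem exists_isDualPair {k : ℕ} {S : Finset ℕ} (hk : 2 ≤ k) (hS : k + 2 ≤ S.card)
    {σ : Finset ℕ → List ℕ} (hσ : IsPreGCO k S σ) (h : IsPseudoGCO k S σ) :
    ∃ τ : Finset ℕ → List ℕ, IsPreGCO (S.card - k) S τ ∧ IsPseudoGCO (S.card - k) S τ ∧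
      IsDualPair k S σ τ := by
  choose! τ hτ using (isPseudoGCO_iff hS σ).1 h
  have hdual : IsDualPair k S σ τ := fun I hI hIc => (hτ I hI hIc).2.2
  refine ⟨τ, fun I hI hIc => ⟨(hτ I hI hIc).1, (hτ I hI hIc).2.1⟩, ?_, hdual⟩
  refine (hdual.symm hS).isPseudoGCO (by omega) ?_
  rwa [Nat.sub_sub_self (by omega)]

/-- The dual of a tuple is unique. -/
theorem IsDualPair.unique {k : ℕ} {S : Finset ℕ} (hk : 2 ≤ k) (hS : k + 2 ≤ S.card)
    {σ τ₁ τ₂ : Finset ℕ → List ℕ} (h₁ : IsPreGCO (S.card - k) S τ₁)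
    (h₂ : IsPreGCO (S.card - k) S τ₂) (hd₁ : IsDualPair k S σ τ₁) (hd₂ : IsDualPair k S σ τ₂)
    {I : Finset ℕ} (hI : I ⊆ S) (hIc : I.card = S.card - k - 2) : DihEquiv (τ₁ I) (τ₂ I) :=
  dihEquiv_of_descendant (m := k - 2) (by rw [Finset.card_sdiff_of_subset hI]; omega)
    (h₁ I hI hIc).1 (h₁ I hI hIc).2 (h₂ I hI hIc).1 (h₂ I hI hIc).2
    fun J hJ hJc => dihEquiv_trans (dihEquiv_symm (hd₁ I hI hIc J hJ hJc)) (hd₂ I hI hIc J hJ hJc)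

/-- Duality between `(k,n)` and `(n-k,n)` pseudo-GCOs on `{1, …, n}` (with the convention
that a `(2,n)` pseudo-GCO is a single `(2,n)` color ordering, which is built into the
definitions above).  The dual map is well defined: every iterated `k`-preserving
projection of a pseudo-GCO by `n - k - 2` labels is the descendant of a `(2, k+2)` color
ordering which is unique (up to dihedral equivalence of representatives).  The dual of a
pseudo-GCO exists and is an `(n-k, n)` pseudo-GCO, it is unique, the dual map is
injective and surjective onto `(n-k,n)` pseudo-GCOs, and its inverse is the dual map in
the opposite direction. -/
theorem duality_of_pseudoGCOs (k n : ℕ) (hk : 2 ≤ k) (hn : k + 2 ≤ n) :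
    -- well-definedness: each iterated projection is the descendant of a unique
    -- (2, k+2) color ordering
    (∀ σ : Finset ℕ → List ℕ, IsPreGCO k (Finset.Icc 1 n) σ →
      IsPseudoGCO k (Finset.Icc 1 n) σ →
      ∀ I : Finset ℕ, I ⊆ Finset.Icc 1 n → I.card = n - k - 2 →
        (∃ base : List ℕ, base.Nodup ∧ base.toFinset = Finset.Icc 1 n \ I ∧
          ∀ J : Finset ℕ, J ⊆ Finset.Icc 1 n \ I → J.card = k - 2 →
            DihEquiv ((σ J).filter (fun x => x ∉ I)) (base.filter (fun x => x ∉ J))) ∧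
        (∀ base₁ base₂ : List ℕ,
          base₁.Nodup → base₁.toFinset = Finset.Icc 1 n \ I →
          base₂.Nodup → base₂.toFinset = Finset.Icc 1 n \ I →
          (∀ J : Finset ℕ, J ⊆ Finset.Icc 1 n \ I → J.card = k - 2 →
            DihEquiv ((σ J).filter (fun x => x ∉ I)) (base₁.filter (fun x => x ∉ J))) →
          (∀ J : Finset ℕ, J ⊆ Finset.Icc 1 n \ I → J.card = k - 2 →
            DihEquiv ((σ J).filter (fun x => x ∉ I)) (base₂.filter (fun x => x ∉ J))) →
          DihEquiv base₁ base₂)) ∧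
    -- existence: the dual exists and is an (n-k, n) pseudo-GCO
    (∀ σ : Finset ℕ → List ℕ, IsPreGCO k (Finset.Icc 1 n) σ →
      IsPseudoGCO k (Finset.Icc 1 n) σ →
      ∃ τ : Finset ℕ → List ℕ, IsPreGCO (n - k) (Finset.Icc 1 n) τ ∧
        IsPseudoGCO (n - k) (Finset.Icc 1 n) τ ∧ IsDualPair k (Finset.Icc 1 n) σ τ) ∧
    -- uniqueness of the dual (as a tuple of color orderings)
    (∀ σ τ₁ τ₂ : Finset ℕ → List ℕ, IsPreGCO k (Finset.Icc 1 n) σ →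
      IsPreGCO (n - k) (Finset.Icc 1 n) τ₁ → IsPreGCO (n - k) (Finset.Icc 1 n) τ₂ →
      IsDualPair k (Finset.Icc 1 n) σ τ₁ → IsDualPair k (Finset.Icc 1 n) σ τ₂ →
      ∀ I : Finset ℕ, I ⊆ Finset.Icc 1 n → I.card = n - k - 2 →
        DihEquiv (τ₁ I) (τ₂ I)) ∧
    -- injectivity of the dual map
    (∀ σ₁ σ₂ τ : Finset ℕ → List ℕ, IsPreGCO k (Finset.Icc 1 n) σ₁ →
      IsPreGCO k (Finset.Icc 1 n) σ₂ → IsPreGCO (n - k) (Finset.Icc 1 n) τ →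
      IsDualPair k (Finset.Icc 1 n) σ₁ τ → IsDualPair k (Finset.Icc 1 n) σ₂ τ →
      ∀ J : Finset ℕ, J ⊆ Finset.Icc 1 n → J.card = k - 2 →
        DihEquiv (σ₁ J) (σ₂ J)) ∧
    -- surjectivity onto (n-k, n) pseudo-GCOs
    (∀ τ : Finset ℕ → List ℕ, IsPreGCO (n - k) (Finset.Icc 1 n) τ →
      IsPseudoGCO (n - k) (Finset.Icc 1 n) τ →
      ∃ σ : Finset ℕ → List ℕ, IsPreGCO k (Finset.Icc 1 n) σ ∧
        IsPseudoGCO k (Finset.Icc 1 n) σ ∧ IsDualPair k (Finset.Icc 1 n) σ τ) ∧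
    -- the inverse of the dual map is the dual map in the opposite direction
    (∀ σ τ : Finset ℕ → List ℕ, IsPreGCO k (Finset.Icc 1 n) σ →
      IsPseudoGCO k (Finset.Icc 1 n) σ → IsPreGCO (n - k) (Finset.Icc 1 n) τ →
      IsPseudoGCO (n - k) (Finset.Icc 1 n) τ →
      (IsDualPair k (Finset.Icc 1 n) σ τ ↔ IsDualPair (n - k) (Finset.Icc 1 n) τ σ)) := by
  obtain ⟨S, hSdef⟩ : ∃ S, S = Finset.Icc 1 n := ⟨_, rfl⟩
  have hc : S.card = n := by rw [hSdef]; simp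
  rw [← hSdef]
  clear hSdef
  subst hc
  have hk' : 2 ≤ S.card - k := by omega
  have hn' : S.card - k + 2 ≤ S.card := by omega
  have hkk : S.card - (S.card - k) = k := Nat.sub_sub_self (by omega)
  refine ⟨fun σ _ h I hI hIc => ⟨(isPseudoGCO_iff hn σ).1 h I hI hIc, ?_⟩,
    fun σ => exists_isDualPair hk hn, ?_, ?_, ?_, ?_⟩
  · intro b₁ b₂ h₁ hb₁ h₂ hb₂ hd₁ hd₂
    exact dihEquiv_of_descendant (m := k - 2) (by rw [Finset.card_sdiff_of_subset hI]; omega)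
      h₁ hb₁ h₂ hb₂ fun J hJ hJc => dihEquiv_trans (dihEquiv_symm (hd₁ J hJ hJc)) (hd₂ J hJ hJc)
  · intro σ τ₁ τ₂ _ h₁ h₂ hd₁ hd₂ I hI hIc
    exact hd₁.unique hk hn h₁ h₂ hd₂ hI hIc
  · intro σ₁ σ₂ τ h₁ h₂ _ hd₁ hd₂ J hJ hJc
    exact (hd₁.symm hn).unique hk' hn' (by rwa [hkk]) (by rwa [hkk]) (hd₂.symm hn) hJ
      (by rwa [hkk])
  · intro τ hτ h
    obtain ⟨σ, hσ, hσ', hd⟩ := exists_isDualPair hk' hn' hτ h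
    have hd' := hd.symm hn'
    rw [hkk] at hσ hσ' hd'
    exact ⟨σ, hσ, hσ', hd'⟩
  · intro σ τ _ _ _ _
    refine ⟨fun hd => hd.symm hn, fun hd => ?_⟩
    have hd' := hd.symm hn'
    rwa [hkk] at hd'
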